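/- On U(2), the 3-form C^U_{1,3} = (1/(2πi))² · (−1/6) · tr((h⁻¹dh)³) is closed, and on U(2) × U(2) the identity ε₀*C^U_{1,3} − ε₁*C^U_{1,3} + ε₂*C^U_{1,3} + d C^U_{2,2} = 0 holds, where C^U_{2,2} = (1/(2πi))² · (1/2) · tr(h₂⁻¹ h₁⁻¹ dh₁ dh₂) − (1/(2πi))² · (1/2) · tr(h₁⁻¹ dh₁) tr(h₂⁻¹ dh₂). -/

import Mathlib

/-! The second-Chern-class cocycle `C^U_{1,3} + C^U_{2,2}` on the simplicial manifold
`N U(2)`.  Since `U(2)` is an embedded submanifold of the vector space `M₂(ℂ)` of 2×2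
complex matrices, a differential form on `U(2)` given by a global matrix formula is
formalized as the pointwise formula evaluated at points `h ∈ U(2)` on tangent vectors
`v` with `h⁻¹v ∈ 𝔲(2)` (anti-Hermitian); the exterior derivative of such a form is
the (ambient) exterior derivative of the formula, which pulls back to the exterior
derivative on the submanifold. -/

attribute [local instance]
  Matrix.linftyOpNormedAddCommGroup Matrix.linftyOpNormedSpace

noncomputable section

abbrev M2 := Matrix (Fin 2) (Fin 2) ℂ

/-- `v` is tangent to `U(2)` at `h`: `h⁻¹v` is anti-Hermitian. -/
def uTangent (h v : M2) : Prop :=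
  star (h⁻¹ * v) = -(h⁻¹ * v)

/-- The 3-form `C^U_{1,3} = (1/(2πi))² ⬝ (−1/6) ⬝ tr((h⁻¹dh)³)`, evaluated at `h` on
tangent vectors `v 0, v 1, v 2`. -/
def C13U (h : M2) (v : Fin 3 → M2) : ℂ :=
  (1 / (2 * Real.pi * Complex.I)) ^ 2 * (-1 / 6) *
    ∑ σ : Equiv.Perm (Fin 3), ((Equiv.Perm.sign σ : ℤ) : ℂ) *
      (h⁻¹ * v (σ 0) * (h⁻¹ * v (σ 1)) * (h⁻¹ * v (σ 2))).trace

/-- The 2-form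
`C^U_{2,2} = (1/(2πi))² ⬝ (1/2) ⬝ tr(h₂⁻¹h₁⁻¹ dh₁ dh₂)
             − (1/(2πi))² ⬝ (1/2) ⬝ tr(h₁⁻¹dh₁) tr(h₂⁻¹dh₂)`
on `U(2) × U(2)`, evaluated at `(h₁, h₂)` on tangent vectors `v, w`. -/
def C22U (h : M2 × M2) (v w : M2 × M2) : ℂ :=
  (1 / (2 * Real.pi * Complex.I)) ^ 2 * (1 / 2) *
    ((h.2⁻¹ * h.1⁻¹ * v.1 * w.2).trace - (h.2⁻¹ * h.1⁻¹ * w.1 * v.2).trace)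
  - (1 / (2 * Real.pi * Complex.I)) ^ 2 * (1 / 2) *
    ((h.1⁻¹ * v.1).trace * (h.2⁻¹ * w.2).trace -
      (h.1⁻¹ * w.1).trace * (h.2⁻¹ * v.2).trace)

/-- The exterior derivative of a 3-form on (an open set of) the vector space `M₂(ℂ)`:
`(dω)_h(v₀,…,v₃) = ∑ᵢ (−1)ⁱ ∂_{vᵢ} (x ↦ ω_x(v₀,…,v̂ᵢ,…,v₃)) (h)`. -/
def extDeriv3 (ω : M2 → (Fin 3 → M2) → ℂ) (h : M2) (v : Fin 4 → M2) : ℂ :=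
  ∑ i : Fin 4, (-1 : ℂ) ^ (i : ℕ) *
    fderiv ℝ (fun x => ω x (fun j => v (i.succAbove j))) h (v i)

/-- The exterior derivative of a 2-form on (an open set of) `M₂(ℂ) × M₂(ℂ)`. -/
def extDeriv2 (ω : M2 × M2 → M2 × M2 → M2 × M2 → ℂ) (p : M2 × M2) (v : Fin 3 → M2 × M2) : ℂ :=
  ∑ i : Fin 3, (-1 : ℂ) ^ (i : ℕ) *
    fderiv ℝ (fun x => ω x (v (i.succAbove 0)) (v (i.succAbove 1))) p (v i)

section Derivatives

attribute [local instance] Matrix.linftyOpNormedRing Matrix.linftyOpNormedAlgebra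

theorem hasFDerivAt_matrix_inv {h : M2} (hh : IsUnit h) :
    HasFDerivAt (𝕜 := ℝ) (fun x : M2 => x⁻¹)
      (-ContinuousLinearMap.mulLeftRight ℝ M2 h⁻¹ h⁻¹) h := by
  obtain ⟨u, rfl⟩ := hh
  have key := hasFDerivAt_ringInverse (𝕜 := ℝ) u
  rw [← Matrix.coe_units_inv]
  refine key.congr_of_eventuallyEq (Filter.Eventually.of_forall fun x => ?_)
  exact Matrix.nonsing_inv_eq_ringInverse x

theorem HasFDerivAt.matrix_trace {E : Type*} [NormedAddCommGroup E] [NormedSpace ℝ E]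
    {f : E → M2} {f' : E →L[ℝ] M2} {x : E} (hf : HasFDerivAt f f' x) :
    HasFDerivAt (fun y => (f y).trace)
      ((Matrix.traceLinearMap (Fin 2) ℝ ℂ).toContinuousLinearMap.comp f') x :=
  (Matrix.traceLinearMap (Fin 2) ℝ ℂ).toContinuousLinearMap.hasFDerivAt.comp x hf

/-- The derivative of `x ↦ tr(x⁻¹a x⁻¹b x⁻¹c)`. -/
theorem exists_hasFDerivAt_trace_maurerCartan_cube {h : M2} (hh : IsUnit h) (a b c : M2) :
    ∃ L : M2 →L[ℝ] ℂ,
      HasFDerivAt (fun x : M2 => (x⁻¹ * a * (x⁻¹ * b) * (x⁻¹ * c)).trace) L h ∧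
      ∀ v, L v =
        -((h⁻¹ * v * (h⁻¹ * a) * (h⁻¹ * b) * (h⁻¹ * c)).trace
          + (h⁻¹ * a * (h⁻¹ * v) * (h⁻¹ * b) * (h⁻¹ * c)).trace
          + (h⁻¹ * a * (h⁻¹ * b) * (h⁻¹ * v) * (h⁻¹ * c)).trace) := by
  have hi := hasFDerivAt_matrix_inv hh
  refine ⟨_, (((hi.mul_const' a).mul' (hi.mul_const' b)).mul' (hi.mul_const' c)).matrix_trace,
    fun v => ?_⟩
  change ((h⁻¹ * a * (h⁻¹ * b)) * (-(h⁻¹ * v * h⁻¹) * c)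
    + (h⁻¹ * a * (-(h⁻¹ * v * h⁻¹) * b) + -(h⁻¹ * v * h⁻¹) * a * (h⁻¹ * b)) * (h⁻¹ * c)).trace = _
  simp [add_mul, mul_assoc]

/-- The derivative of `(x, y) ↦ tr(y⁻¹x⁻¹ab)`. -/
theorem exists_hasFDerivAt_trace_inv_mul_inv {h : M2 × M2} (h₁ : IsUnit h.1) (h₂ : IsUnit h.2)
    (a b : M2) :
    ∃ L : M2 × M2 →L[ℝ] ℂ,
      HasFDerivAt (fun x : M2 × M2 => (x.2⁻¹ * x.1⁻¹ * a * b).trace) L h ∧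
      ∀ v, L v =
        -((h.2⁻¹ * v.2 * h.2⁻¹ * h.1⁻¹ * a * b).trace
          + (h.2⁻¹ * h.1⁻¹ * v.1 * h.1⁻¹ * a * b).trace) := by
  have hi := (hasFDerivAt_matrix_inv h₁).comp h hasFDerivAt_fst
  have hj := (hasFDerivAt_matrix_inv h₂).comp h hasFDerivAt_snd
  refine ⟨_, (((hj.mul' hi).mul_const' a).mul_const' b).matrix_trace, fun v => ?_⟩
  change ((h.2⁻¹ * -(h.1⁻¹ * v.1 * h.1⁻¹) + -(h.2⁻¹ * v.2 * h.2⁻¹) * h.1⁻¹) * a * b).trace = _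
  simp [add_mul, mul_assoc]

/-- The derivative of `(x, y) ↦ tr(x⁻¹a) tr(y⁻¹b)`. -/
theorem exists_hasFDerivAt_trace_mul_trace {h : M2 × M2} (h₁ : IsUnit h.1) (h₂ : IsUnit h.2)
    (a b : M2) :
    ∃ L : M2 × M2 →L[ℝ] ℂ,
      HasFDerivAt (fun x : M2 × M2 => (x.1⁻¹ * a).trace * (x.2⁻¹ * b).trace) L h ∧
      ∀ v, L v =
        -((h.1⁻¹ * v.1 * (h.1⁻¹ * a)).trace * (h.2⁻¹ * b).trace
          + (h.1⁻¹ * a).trace * (h.2⁻¹ * v.2 * (h.2⁻¹ * b)).trace) := by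
  have hi := (hasFDerivAt_matrix_inv h₁).comp h hasFDerivAt_fst
  have hj := (hasFDerivAt_matrix_inv h₂).comp h hasFDerivAt_snd
  refine ⟨_, (hi.mul_const' a).matrix_trace.mul (hj.mul_const' b).matrix_trace, fun v => ?_⟩
  change (h.1⁻¹ * a).trace * (-(h.2⁻¹ * v.2 * h.2⁻¹) * b).trace
    + (h.2⁻¹ * b).trace * (-(h.1⁻¹ * v.1 * h.1⁻¹) * a).trace = _
  simp [mul_assoc]
  ring

end Derivatives

theorem sum_sign_perm_fin_three (f : Fin 3 → Fin 3 → Fin 3 → ℂ) :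
    ∑ σ : Equiv.Perm (Fin 3), ((Equiv.Perm.sign σ : ℤ) : ℂ) * f (σ 0) (σ 1) (σ 2)
      = f 0 1 2 - f 0 2 1 - f 1 0 2 + f 1 2 0 + f 2 0 1 - f 2 1 0 := by
  have hu : (Finset.univ : Finset (Equiv.Perm (Fin 3))) =
      {1, Equiv.swap 1 2, Equiv.swap 0 1, Equiv.swap 0 1 * Equiv.swap 1 2,
        Equiv.swap 1 2 * Equiv.swap 0 1, Equiv.swap 0 2} := by decide
  rw [hu]
  iterate 5 rw [Finset.sum_insert (by decide)]
  rw [Finset.sum_singleton]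
  simp [Equiv.swap_apply_def]
  ring

/-- By cyclicity of the trace, `C^U_{1,3}` is `(1/(2πi))² ⬝ (−1/2)` times
`tr(a₀a₁a₂) − tr(a₀a₂a₁)`, where `aᵢ = h⁻¹vᵢ`. -/
theorem C13U_eq (h : M2) (v : Fin 3 → M2) :
    C13U h v = (1 / (2 * Real.pi * Complex.I)) ^ 2 * (-1 / 2) *
      ((h⁻¹ * v 0 * (h⁻¹ * v 1) * (h⁻¹ * v 2)).trace
        - (h⁻¹ * v 0 * (h⁻¹ * v 2) * (h⁻¹ * v 1)).trace) := by
  rw [C13U, sum_sign_perm_fin_three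
    (fun i j k => (h⁻¹ * v i * (h⁻¹ * v j) * (h⁻¹ * v k)).trace)]
  rw [Matrix.trace_mul_cycle (h⁻¹ * v 1) (h⁻¹ * v 0), Matrix.trace_mul_cycle (h⁻¹ * v 2) (h⁻¹ * v 1),
    Matrix.trace_mul_cycle (h⁻¹ * v 1) (h⁻¹ * v 2), Matrix.trace_mul_cycle (h⁻¹ * v 2) (h⁻¹ * v 0),
    Matrix.trace_mul_cycle (h⁻¹ * v 1) (h⁻¹ * v 2)]
  ring

theorem C13U_eq_of_conj {h g : M2} (hg : IsUnit g) {v c : Fin 3 → M2}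
    (hv : ∀ i, h⁻¹ * v i = g⁻¹ * c i * g) :
    C13U h v = (1 / (2 * Real.pi * Complex.I)) ^ 2 * (-1 / 2) *
      ((c 0 * c 1 * c 2).trace - (c 0 * c 2 * c 1).trace) := by
  have hd : IsUnit g.det := (Matrix.isUnit_iff_isUnit_det g).mp hg
  have key (a b c : M2) :
      (g⁻¹ * a * g * (g⁻¹ * b * g) * (g⁻¹ * c * g)).trace = (a * b * c).trace := by
    have hab : g⁻¹ * a * g * (g⁻¹ * b * g) * (g⁻¹ * c * g) = g⁻¹ * (a * b * c) * g := by
      simp only [mul_assoc, Matrix.mul_nonsing_inv_cancel_left _ _ hd]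
    rw [hab, Matrix.trace_mul_comm, Matrix.mul_nonsing_inv_cancel_left _ _ hd]
  rw [C13U_eq]
  simp only [hv, key]

theorem extDeriv3_C13U_eq_zero {h : M2} (hh : IsUnit h) (v : Fin 4 → M2) :
    extDeriv3 C13U h v = 0 := by
  have hD (a b c w : M2) :
      fderiv ℝ (fun x : M2 => (1 / (2 * Real.pi * Complex.I)) ^ 2 * (-1 / 2) *
        ((x⁻¹ * a * (x⁻¹ * b) * (x⁻¹ * c)).trace
          - (x⁻¹ * a * (x⁻¹ * c) * (x⁻¹ * b)).trace)) h w =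
      (1 / (2 * Real.pi * Complex.I)) ^ 2 * (-1 / 2) *
      (-((h⁻¹ * w * (h⁻¹ * a) * (h⁻¹ * b) * (h⁻¹ * c)).trace
          + (h⁻¹ * a * (h⁻¹ * w) * (h⁻¹ * b) * (h⁻¹ * c)).trace
          + (h⁻¹ * a * (h⁻¹ * b) * (h⁻¹ * w) * (h⁻¹ * c)).trace)
        + ((h⁻¹ * w * (h⁻¹ * a) * (h⁻¹ * c) * (h⁻¹ * b)).trace
          + (h⁻¹ * a * (h⁻¹ * w) * (h⁻¹ * c) * (h⁻¹ * b)).trace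
          + (h⁻¹ * a * (h⁻¹ * c) * (h⁻¹ * w) * (h⁻¹ * b)).trace)) := by
    obtain ⟨L, hL, hLv⟩ := exists_hasFDerivAt_trace_maurerCartan_cube hh a b c
    obtain ⟨M, hM, hMv⟩ := exists_hasFDerivAt_trace_maurerCartan_cube hh a c b
    refine (DFunLike.congr_fun (HasFDerivAt.fderiv ((hL.fun_sub hM).const_mul _)) w).trans ?_
    change _ * (L w - M w) = _
    rw [hLv, hMv]
    ring
  have hcyc (a b c d : M2) : (a * b * c * d).trace = (b * c * d * a).trace := by
    rw [mul_assoc, mul_assoc, Matrix.trace_mul_comm, ← mul_assoc]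
  simp only [extDeriv3, C13U_eq, hD, Fin.sum_univ_four]
  simp [Fin.succAbove, Fin.lt_def, -mul_eq_zero]
  generalize h⁻¹ * v 0 = a
  generalize h⁻¹ * v 1 = b
  generalize h⁻¹ * v 2 = c
  generalize h⁻¹ * v 3 = d
  rw [hcyc b c a d, hcyc b d a c, hcyc b a c d, hcyc b a d c, hcyc c a b d, hcyc c a d b,
    hcyc d a b c, hcyc d a c b]
  ring

theorem C13U_polyakovWiegmann {h₁ h₂ : M2} (hh₁ : IsUnit h₁) (hh₂ : IsUnit h₂)
    (v : Fin 3 → M2 × M2) :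
    C13U h₂ (fun i => (v i).2)
      - C13U (h₁ * h₂) (fun i => (v i).1 * h₂ + h₁ * (v i).2)
      + C13U h₁ (fun i => (v i).1)
      + extDeriv2 C22U (h₁, h₂) v = 0 := by
  have hd₁ : IsUnit h₁.det := (Matrix.isUnit_iff_isUnit_det h₁).mp hh₁
  have hd₂ : IsUnit h₂.det := (Matrix.isUnit_iff_isUnit_det h₂).mp hh₂
  have hD (p q w : M2 × M2) :
      fderiv ℝ (fun x : M2 × M2 => C22U x p q) (h₁, h₂) w =
      (1 / (2 * Real.pi * Complex.I)) ^ 2 * (1 / 2) *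
      (-((h₂⁻¹ * w.2 * h₂⁻¹ * h₁⁻¹ * p.1 * q.2).trace
          + (h₂⁻¹ * h₁⁻¹ * w.1 * h₁⁻¹ * p.1 * q.2).trace)
        + ((h₂⁻¹ * w.2 * h₂⁻¹ * h₁⁻¹ * q.1 * p.2).trace
          + (h₂⁻¹ * h₁⁻¹ * w.1 * h₁⁻¹ * q.1 * p.2).trace)
        + ((h₁⁻¹ * w.1 * (h₁⁻¹ * p.1)).trace * (h₂⁻¹ * q.2).trace
          + (h₁⁻¹ * p.1).trace * (h₂⁻¹ * w.2 * (h₂⁻¹ * q.2)).trace)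
        - ((h₁⁻¹ * w.1 * (h₁⁻¹ * q.1)).trace * (h₂⁻¹ * p.2).trace
          + (h₁⁻¹ * q.1).trace * (h₂⁻¹ * w.2 * (h₂⁻¹ * p.2)).trace)) := by
    obtain ⟨L, hL, hLv⟩ := exists_hasFDerivAt_trace_inv_mul_inv (h := (h₁, h₂)) hh₁ hh₂ p.1 q.2
    obtain ⟨M, hM, hMv⟩ := exists_hasFDerivAt_trace_inv_mul_inv (h := (h₁, h₂)) hh₁ hh₂ q.1 p.2
    obtain ⟨N, hN, hNv⟩ := exists_hasFDerivAt_trace_mul_trace (h := (h₁, h₂)) hh₁ hh₂ p.1 q.2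
    obtain ⟨K, hK, hKv⟩ := exists_hasFDerivAt_trace_mul_trace (h := (h₁, h₂)) hh₁ hh₂ q.1 p.2
    refine (DFunLike.congr_fun (HasFDerivAt.fderiv (((hL.fun_sub hM).const_mul _).fun_sub
      ((hN.fun_sub hK).const_mul _))) w).trans ?_
    change _ * (L w - M w) - _ * (N w - K w) = _
    rw [hLv, hMv, hNv, hKv]
    ring
  rw [C13U_eq_of_conj (c := fun i => (v i).2 * h₂⁻¹) hh₂ (fun i => by
      simp only [mul_assoc, Matrix.nonsing_inv_mul _ hd₂, mul_one]),
    C13U_eq_of_conj (c := fun i => h₁⁻¹ * (v i).1 + (v i).2 * h₂⁻¹) hh₂ (fun i => by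
      simp only [Matrix.mul_inv_rev, mul_add, add_mul, mul_assoc, Matrix.nonsing_inv_mul _ hd₂,
        Matrix.nonsing_inv_mul_cancel_left _ _ hd₁, mul_one]),
    C13U_eq]
  have hbab (x y z : M2) : (h₂⁻¹ * x * h₂⁻¹ * h₁⁻¹ * y * z).trace =
      (x * h₂⁻¹ * (h₁⁻¹ * y) * (z * h₂⁻¹)).trace := by
    simp only [mul_assoc]
    rw [Matrix.trace_mul_comm]
    simp only [mul_assoc]
  have haab (x y z : M2) : (h₂⁻¹ * h₁⁻¹ * x * h₁⁻¹ * y * z).trace =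
      (h₁⁻¹ * x * (h₁⁻¹ * y) * (z * h₂⁻¹)).trace := by
    simp only [mul_assoc]
    rw [Matrix.trace_mul_comm]
    simp only [mul_assoc]
  have hbb (x y : M2) : (h₂⁻¹ * x * (h₂⁻¹ * y)).trace = (x * h₂⁻¹ * (y * h₂⁻¹)).trace := by
    simp only [mul_assoc]
    rw [Matrix.trace_mul_comm]
    simp only [mul_assoc]
  simp only [extDeriv2, hD, Fin.sum_univ_three, hbab, haab, hbb, Matrix.trace_mul_comm h₂⁻¹]
  simp [Fin.succAbove, Fin.lt_def, -mul_eq_zero]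
  generalize h₁⁻¹ * (v 0).1 = a₀
  generalize h₁⁻¹ * (v 1).1 = a₁
  generalize h₁⁻¹ * (v 2).1 = a₂
  generalize (v 0).2 * h₂⁻¹ = b₀
  generalize (v 1).2 * h₂⁻¹ = b₁
  generalize (v 2).2 * h₂⁻¹ = b₂
  have hcyc (a b c : M2) : (a * b * c).trace = (b * c * a).trace := by
    rw [mul_assoc, Matrix.trace_mul_comm]
  simp only [add_mul, mul_add, Matrix.trace_add]
  rw [hcyc b₁ a₀ b₂, hcyc b₂ a₀ b₁, hcyc a₁ a₀ b₂, hcyc a₂ a₀ b₁,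
    ← hcyc b₀ b₁ a₂, ← hcyc b₀ b₂ a₁, ← hcyc b₀ a₁ a₂, ← hcyc b₀ a₂ a₁,
    Matrix.trace_mul_comm a₁ a₀, Matrix.trace_mul_comm a₂ a₀, Matrix.trace_mul_comm a₂ a₁,
    Matrix.trace_mul_comm b₁ b₀, Matrix.trace_mul_comm b₂ b₀, Matrix.trace_mul_comm b₂ b₁]
  ring

theorem isUnit_of_mem_unitaryGroup {h : M2} (hh : h ∈ Matrix.unitaryGroup (Fin 2) ℂ) :
    IsUnit h :=
  (Unitary.toUnits ⟨h, hh⟩).isUnit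

/-- On `U(2)` the 3-form `C^U_{1,3}` is closed, and on `U(2) × U(2)` the identity
`ε₀*C^U_{1,3} − ε₁*C^U_{1,3} + ε₂*C^U_{1,3} + dC^U_{2,2} = 0` holds, where the nerve
face maps are `ε₀(h₁,h₂) = h₂`, `ε₁(h₁,h₂) = h₁h₂`, `ε₂(h₁,h₂) = h₁` (so the
differential of `ε₁` sends `(v₁, v₂)` to `v₁h₂ + h₁v₂`). -/
theorem C13U_closed_and_polyakovWiegmann :
    (∀ h : M2, h ∈ Matrix.unitaryGroup (Fin 2) ℂ →
      ∀ v : Fin 4 → M2, (∀ i, uTangent h (v i)) → extDeriv3 C13U h v = 0) ∧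
    (∀ h₁ h₂ : M2, h₁ ∈ Matrix.unitaryGroup (Fin 2) ℂ →
      h₂ ∈ Matrix.unitaryGroup (Fin 2) ℂ →
      ∀ v : Fin 3 → M2 × M2, (∀ i, uTangent h₁ (v i).1 ∧ uTangent h₂ (v i).2) →
        C13U h₂ (fun i => (v i).2)
          - C13U (h₁ * h₂) (fun i => (v i).1 * h₂ + h₁ * (v i).2)
          + C13U h₁ (fun i => (v i).1)
          + extDeriv2 C22U (h₁, h₂) v = 0) := by
  refine ⟨fun h hh v _ => extDeriv3_C13U_eq_zero (isUnit_of_mem_unitaryGroup hh) v,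
    fun h₁ h₂ hh₁ hh₂ v _ => C13U_polyakovWiegmann (isUnit_of_mem_unitaryGroup hh₁)
      (isUnit_of_mem_unitaryGroup hh₂) v⟩
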